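/- Theorem (Colliot-Thélène–Levine). Let k be a field of characteristic ≠ 2, let N, M be natural numbers, and let q_0, q_1, …, q_M be quadratic forms on k^(N+1). Let F = k(t_1, …, t_M) be the purely transcendental extension FractionRing (MvPolynomial (Fin M) k) and let q_η be the quadratic form q_0 + t_1·q_1 + ⋯ + t_M·q_M on F^(N+1) (each q_i base-changed to F). Then the following are equivalent: (a) there exist a finite field extension E/F of odd degree and a nonzero vector v ∈ E^(N+1) with q_η(v) = 0; (b) there exist a finite field extension L/k of odd degree and a nonzero vector w ∈ L^(N+1) with q_i(w) = 0 for every i = 0, …, M. -/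

import Mathlib

noncomputable section

open scoped BigOperators

/-- A quadratic form is *isotropic* if it vanishes on some nonzero vector. -/
def QuadraticMap.IsIsotropic {R M : Type*} [CommSemiring R] [AddCommMonoid M] [Module R M]
    (q : QuadraticForm R M) : Prop :=
  ∃ v, v ≠ 0 ∧ q v = 0

/-- `p` is a subform of `q` -/
def QuadraticMap.IsSubform {R M₁ M₂ : Type*} [CommSemiring R] [AddCommMonoid M₁]
    [AddCommMonoid M₂] [Module R M₁] [Module R M₂]
    (p : QuadraticForm R M₁) (q : QuadraticForm R M₂) : Prop :=
  ∃ f : M₁ →ₗ[R] M₂, Function.Injective f ∧ ∀ v, q (f v) = p v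

/-- Base change of a quadratic form on `k^n` along a ring homomorphism `f : k →+* E`:
the quadratic form on `E^n` whose values on the standard basis vectors, and whose polar
values on pairs of standard basis vectors, are the images under `f` of those of `q`. -/
def QuadraticForm.mapAlong {k E : Type*} [CommRing k] [CommRing E] (f : k →+* E) {n : ℕ}
    (q : QuadraticForm k (Fin n → k)) : QuadraticForm E (Fin n → E) :=
  Matrix.toQuadraticMap' (Matrix.of fun i j =>
    if i = j then f (q (Pi.single i 1))
    else if i < j then f (QuadraticMap.polar ⇑q (Pi.single i 1) (Pi.single j 1)) else 0)

/-- The `n`-fold Pfister form `⟨⟨a_1, …, a_n⟩⟩`: the diagonal quadratic form of rank `2^n`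
whose diagonal entries, indexed by the subsets `S ⊆ {1, …, n}`, are `∏_{i ∈ S} (-a_i)`. -/
def PfisterForm {F : Type*} [Field F] {n : ℕ} (a : Fin n → F) :
    QuadraticForm F (Finset (Fin n) → F) :=
  QuadraticMap.weightedSumSquares F (fun S : Finset (Fin n) => ∏ i ∈ S, (-a i))

/-- The canonical ring embedding of `F` into `F(x_1, …, x_m)`. -/
def toFrac (F : Type*) [Field F] (m : ℕ) : F →+* FractionRing (MvPolynomial (Fin m) F) :=
  (algebraMap (MvPolynomial (Fin m) F) (FractionRing (MvPolynomial (Fin m) F))).comp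
    MvPolynomial.C

/-- The canonical embedding `F(x_1, …, x_m) → L(x_1, …, x_m)` induced by `F → L`. -/
def transMap (F L : Type*) [Field F] [Field L] [Algebra F L] (m : ℕ) :
    FractionRing (MvPolynomial (Fin m) F) →+* FractionRing (MvPolynomial (Fin m) L) :=
  IsFractionRing.lift (g := (algebraMap (MvPolynomial (Fin m) L)
      (FractionRing (MvPolynomial (Fin m) L))).comp (MvPolynomial.map (algebraMap F L)))
    (((IsFractionRing.injective (MvPolynomial (Fin m) L)
        (FractionRing (MvPolynomial (Fin m) L))).comp
      (MvPolynomial.map_injective _ (algebraMap F L).injective)))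

/-- The generic value `p(X)` of a quadratic form `p` on `k^n`: the value of the base change
of `p` to `k(X_1, …, X_n)` at the vector of indeterminates. -/
def genericValue {k : Type*} [Field k] {n : ℕ} (p : QuadraticForm k (Fin n → k)) :
    FractionRing (MvPolynomial (Fin n) k) :=
  (p.mapAlong (toFrac k n)) fun i =>
    algebraMap (MvPolynomial (Fin n) k) (FractionRing (MvPolynomial (Fin n) k))
      (MvPolynomial.X i)

/-- `E` is a finite extension of odd degree of `F`, via the ring homomorphism `f`. -/
def IsOddFiniteExt (F E : Type*) [Field F] [Field E] (f : F →+* E) : Prop :=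
  letI : Algebra F E := f.toAlgebra
  FiniteDimensional F E ∧ Odd (Module.finrank F E)

universe u

/-- The value at `v` of the quadratic form `∑ B i j * x i * x j`. -/
def Matrix.quadEval {R ι : Type*} [Fintype ι] [CommSemiring R] (B : Matrix ι ι R) (v : ι → R) : R :=
  ∑ i, ∑ j, B i j * v i * v j

/-- The forms given by the matrices in `S` have a common nontrivial zero over some finite
extension of odd degree. -/
def HasOddZero {ι : Type*} [Fintype ι] {K : Type u} [Field K] (S : Set (Matrix ι ι K)) : Prop :=
  ∃ (L : Type u) (_ : Field L) (g : K →+* L), IsOddFiniteExt K L g ∧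
    ∃ w : ι → L, w ≠ 0 ∧ ∀ B ∈ S, (B.map g).quadEval w = 0

section QuadEval

variable {R R' ι : Type*} [Fintype ι] [CommSemiring R] [CommSemiring R']

lemma Matrix.quadEval_map (f : R →+* R') (B : Matrix ι ι R) (v : ι → R) :
    (B.map f).quadEval (fun i => f (v i)) = f (B.quadEval v) := by
  simp [Matrix.quadEval, map_sum, map_mul]

lemma Matrix.quadEval_smul (B : Matrix ι ι R) (c : R) (v : ι → R) :
    B.quadEval (fun i => c * v i) = c ^ 2 * B.quadEval v := by
  simp only [Matrix.quadEval, Finset.mul_sum]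
  refine Finset.sum_congr rfl fun i _ => Finset.sum_congr rfl fun j _ => by ring

lemma Matrix.quadEval_add (A B : Matrix ι ι R) (v : ι → R) :
    (A + B).quadEval v = A.quadEval v + B.quadEval v := by
  simp [Matrix.quadEval, add_mul, Finset.sum_add_distrib]

lemma Matrix.quadEval_const_smul (c : R) (B : Matrix ι ι R) (v : ι → R) :
    (c • B).quadEval v = c * B.quadEval v := by
  simp only [Matrix.quadEval, Finset.mul_sum, Matrix.smul_apply, smul_eq_mul, mul_assoc]

lemma Matrix.quadEval_sum {α : Type*} (s : Finset α) (B : α → Matrix ι ι R) (v : ι → R) :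
    (∑ a ∈ s, B a).quadEval v = ∑ a ∈ s, (B a).quadEval v := by
  classical
  induction s using Finset.induction_on with
  | empty => simp [Matrix.quadEval]
  | insert a s ha ih => rw [Finset.sum_insert ha, Finset.sum_insert ha, Matrix.quadEval_add, ih]

end QuadEval

section MatrixOfForm

variable {k E : Type*} [CommRing k] [CommRing E] {n : ℕ}

/-- The upper triangular matrix of a quadratic form on `k^n`. -/
def QuadraticForm.upperMatrix (q : QuadraticForm k (Fin n → k)) : Matrix (Fin n) (Fin n) k :=
  Matrix.of fun i j =>
    if i = j then q (Pi.single i 1)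
    else if i < j then QuadraticMap.polar ⇑q (Pi.single i 1) (Pi.single j 1) else 0

lemma QuadraticForm.mapAlong_apply (f : k →+* E) (q : QuadraticForm k (Fin n → k))
    (v : Fin n → E) : q.mapAlong f v = (q.upperMatrix.map f).quadEval v := by
  have : (Matrix.of fun i j =>
      if i = j then f (q (Pi.single i 1))
      else if i < j then f (QuadraticMap.polar ⇑q (Pi.single i 1) (Pi.single j 1)) else 0)
      = q.upperMatrix.map f := by
    ext i j
    simp only [QuadraticForm.upperMatrix, Matrix.of_apply, Matrix.map_apply]
    split_ifs <;> simp
  rw [QuadraticForm.mapAlong, this, Matrix.quadEval]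
  simp only [Matrix.toQuadraticMap', Matrix.toQuadraticForm', LinearMap.BilinMap.toQuadraticMap_apply,
    Matrix.toLinearMap₂'_apply', dotProduct, Matrix.mulVec, Finset.mul_sum]
  refine Finset.sum_congr rfl fun i _ => Finset.sum_congr rfl fun j _ => by ring

lemma QuadraticForm.upperMatrix_mapAlong (f : k →+* E) (q : QuadraticForm k (Fin n → k)) :
    (q.mapAlong f).upperMatrix = q.upperMatrix.map f := by
  ext i j
  have h1 : ∀ i, (q.mapAlong f) (Pi.single i 1) = f (q (Pi.single i 1)) := by
    intro i
    rw [QuadraticForm.mapAlong_apply, Matrix.quadEval]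
    simp [Pi.single_apply, QuadraticForm.upperMatrix]
  simp only [QuadraticForm.upperMatrix, Matrix.of_apply, Matrix.map_apply]
  split_ifs with h h'
  · exact h1 i
  · rw [QuadraticMap.polar, h1, h1, QuadraticForm.mapAlong_apply, Matrix.quadEval]
    simp [Pi.single_apply, QuadraticForm.upperMatrix, mul_add, Finset.sum_add_distrib,
      h, Ne.symm h, h', h'.not_gt]
  · simp

lemma QuadraticForm.upperMatrix_add (p q : QuadraticForm k (Fin n → k)) :
    (p + q).upperMatrix = p.upperMatrix + q.upperMatrix := by
  ext i j
  simp only [QuadraticForm.upperMatrix, Matrix.of_apply, Matrix.add_apply]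
  split_ifs <;> simp [QuadraticMap.polar_add]

lemma QuadraticForm.upperMatrix_smul (c : k) (q : QuadraticForm k (Fin n → k)) :
    (c • q).upperMatrix = c • q.upperMatrix := by
  ext i j
  simp only [QuadraticForm.upperMatrix, Matrix.of_apply, Matrix.smul_apply]
  split_ifs <;> simp [QuadraticMap.polar_smul]

lemma QuadraticForm.upperMatrix_sum {α : Type*} (s : Finset α)
    (q : α → QuadraticForm k (Fin n → k)) :
    (∑ a ∈ s, q a).upperMatrix = ∑ a ∈ s, (q a).upperMatrix := by
  classical
  induction s using Finset.induction_on with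
  | empty =>
    ext i j
    simp [QuadraticForm.upperMatrix, QuadraticMap.polar]
  | insert a s ha ih =>
    rw [Finset.sum_insert ha, Finset.sum_insert ha, QuadraticForm.upperMatrix_add, ih]

end MatrixOfForm

lemma IsOddFiniteExt.of_algebra (F E : Type*) [Field F] [Field E] [Algebra F E]
    [hf : FiniteDimensional F E] (h : Odd (Module.finrank F E)) :
    IsOddFiniteExt F E (algebraMap F E) := by
  rw [IsOddFiniteExt, show (algebraMap F E).toAlgebra = ‹Algebra F E› from
    Algebra.algebra_ext _ _ fun _ => rfl]
  exact ⟨hf, h⟩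

lemma IsOddFiniteExt.comp {F E L : Type*} [Field F] [Field E] [Field L] {f : F →+* E} {g : E →+* L}
    (hf : IsOddFiniteExt F E f) (hg : IsOddFiniteExt E L g) : IsOddFiniteExt F L (g.comp f) := by
  let := f.toAlgebra
  let := g.toAlgebra
  let := (g.comp f).toAlgebra
  have : IsScalarTower F E L := IsScalarTower.of_algebraMap_eq fun _ => rfl
  obtain ⟨h1, h2⟩ := hf
  obtain ⟨h3, h4⟩ := hg
  exact ⟨Module.Finite.trans E L, (Module.finrank_mul_finrank F E L) ▸ h2.mul h4⟩

open Polynomial in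
lemma Polynomial.exists_irreducible_dvd_odd {F : Type*} [Field F] (p : F[X])
    (hp : Odd p.natDegree) : ∃ g, Irreducible g ∧ g ∣ p ∧ Odd g.natDegree := by
  by_contra! H
  have hp0 : p ≠ 0 := by rintro rfl; simp at hp
  have : ∀ q : F[X], q ≠ 0 → q ∣ p → Even q.natDegree := by
    intro q
    induction q using UniqueFactorizationMonoid.induction_on_prime with
    | h₁ => simp
    | h₂ x hx => intro _ _; rw [natDegree_eq_zero_of_isUnit hx]; exact Even.zero
    | h₃ a q ha hq ih =>
      intro h hd
      rw [natDegree_mul hq.ne_zero ha]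
      exact (Nat.not_odd_iff_even.1 (H q hq.irreducible ((dvd_mul_right _ _).trans hd))).add
        (ih ha ((dvd_mul_left _ _).trans hd))
  exact Nat.not_even_iff_odd.2 hp (this p hp0 dvd_rfl)

lemma exists_isOddFiniteExt_lift (n : ℕ) : ∀ (F E F' : Type u) [Field F] [Field E] [Field F']
    [Algebra F E] [FiniteDimensional F E] [Algebra F F'], Module.finrank F E = n → Odd n →
    ∃ (E' : Type u) (_ : Field E') (g : F' →+* E') (h : E →+* E'), IsOddFiniteExt F' E' g ∧
      g.comp (algebraMap F F') = h.comp (algebraMap F E) := by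
  induction n using Nat.strong_induction_on with
  | _ n ih =>
  intro F E F' _ _ _ _ _ _ hn hodd
  by_cases hall : ∀ a : E, a ∈ (⊥ : IntermediateField F E)
  · have hb : (⊥ : IntermediateField F E) = ⊤ := by ext; simp [hall]
    let e : E ≃ₐ[F] F := (IntermediateField.topEquiv.symm.trans
      (IntermediateField.equivOfEq hb.symm)).trans (IntermediateField.botEquiv F E)
    refine ⟨F', _, RingHom.id F', (algebraMap F F').comp e.toRingEquiv.toRingHom, ?_, ?_⟩
    · exact IsOddFiniteExt.of_algebra F' F' (by simp)
    · ext x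
      simp
  push Not at hall
  obtain ⟨a, ha⟩ := hall
  have hai : IsIntegral F a := Algebra.IsIntegral.isIntegral a
  have hmul := Module.finrank_mul_finrank F (IntermediateField.adjoin F {a}) E
  have hdeg := IntermediateField.adjoin.finrank hai
  have hd1 : Odd (minpoly F a).natDegree := by
    rw [← hdeg]; rw [hn] at hmul; rw [← hmul] at hodd; exact (Nat.odd_mul.1 hodd).1
  have hd2 : Odd (Module.finrank (IntermediateField.adjoin F {a}) E) := by
    rw [hn] at hmul; rw [← hmul] at hodd; exact (Nat.odd_mul.1 hodd).2
  have hne : (minpoly F a).natDegree ≠ 1 := by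
    rw [← hdeg]
    intro h
    rw [IntermediateField.finrank_adjoin_simple_eq_one_iff] at h
    exact ha h
  obtain ⟨g, hg, hgd, hgo⟩ := Polynomial.exists_irreducible_dvd_odd
    ((minpoly F a).map (algebraMap F F')) (by rwa [Polynomial.natDegree_map])
  have : Fact (Irreducible g) := ⟨hg⟩
  let : Algebra F (AdjoinRoot g) := ((algebraMap F' (AdjoinRoot g)).comp (algebraMap F F')).toAlgebra
  let φ : IntermediateField.adjoin F {a} →ₐ[F] AdjoinRoot g :=
    (IntermediateField.algHomAdjoinIntegralEquiv F hai).symm ⟨AdjoinRoot.root g, by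
      rw [Polynomial.mem_aroots]
      refine ⟨minpoly.ne_zero hai, ?_⟩
      have h0 : Polynomial.aeval (AdjoinRoot.root g) ((minpoly F a).map (algebraMap F F')) = 0 := by
        rw [AdjoinRoot.aeval_eq, AdjoinRoot.mk_eq_zero]; exact hgd
      rw [Polynomial.aeval_def, Polynomial.eval₂_map] at h0
      exact h0⟩
  let : Algebra (IntermediateField.adjoin F {a}) (AdjoinRoot g) := φ.toRingHom.toAlgebra
  have hpos : 0 < Module.finrank (IntermediateField.adjoin F {a}) E := Module.finrank_pos
  have hlt : Module.finrank (IntermediateField.adjoin F {a}) E < n := by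
    rw [← hn, ← hmul, hdeg]
    have := hd1.pos
    have : 1 < (minpoly F a).natDegree := by omega
    nlinarith
  obtain ⟨E', _, g', h', ho, hc⟩ := ih _ hlt (IntermediateField.adjoin F {a}) E (AdjoinRoot g) rfl hd2
  refine ⟨E', _, g'.comp (algebraMap F' (AdjoinRoot g)), h', ?_, ?_⟩
  · refine IsOddFiniteExt.comp ?_ ho
    let pb := AdjoinRoot.powerBasis hg.ne_zero
    have := pb.finite
    apply IsOddFiniteExt.of_algebra
    rw [pb.finrank]
    simpa [pb] using hgo
  · have h1 : algebraMap F E = (algebraMap (IntermediateField.adjoin F {a}) E).comp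
        (algebraMap F (IntermediateField.adjoin F {a})) := rfl
    rw [h1, ← RingHom.comp_assoc, ← hc, RingHom.comp_assoc, RingHom.comp_assoc]
    congr 1
    exact φ.comp_algebraMap.symm

lemma HasOddZero.map {ι : Type*} [Fintype ι] {K K' : Type u} [Field K] [Field K'] (f : K →+* K')
    {S : Set (Matrix ι ι K)} (h : HasOddZero S) : HasOddZero ((fun B => B.map f) '' S) := by
  obtain ⟨L, _, g, ⟨hfd, hodd⟩, w, hw, hB⟩ := h
  let := g.toAlgebra
  let := f.toAlgebra
  obtain ⟨E', _, g', h', ho, hc⟩ := exists_isOddFiniteExt_lift _ K L K' rfl hodd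
  refine ⟨E', _, g', ho, fun i => h' (w i), ?_, ?_⟩
  · intro h0
    apply hw
    ext i
    exact (map_eq_zero h').1 (congrFun h0 i)
  · rintro _ ⟨B, hBS, rfl⟩
    have h1 : (B.map f).map g' = (B.map g).map h' := by
      ext i j
      exact DFunLike.congr_fun hc (B i j)
    rw [h1, Matrix.quadEval_map, hB B hBS, map_zero]

section RelNorm

open Ideal

attribute [local instance] FractionRing.liftAlgebra in
/-- `Ideal.relNorm_eq_pow_of_isMaximal` for an extension dominated by a Galois extension. -/
theorem Ideal.relNorm_eq_pow_of_isGalois_tower {R S : Type*} [CommRing R] [IsDedekindDomain R]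
    [CommRing S] [IsDedekindDomain S] [Algebra R S] [Module.Finite R S] [Module.IsTorsionFree R S]
    (T : Type*) [CommRing T] [IsDedekindDomain T] [Algebra R T] [Algebra S T] [IsScalarTower R S T]
    [Module.Finite R T] [Module.Finite S T] [Module.IsTorsionFree R T] [Module.IsTorsionFree S T]
    [IsGalois (FractionRing R) (FractionRing T)]
    (P : Ideal S) (p : Ideal R)
    [P.LiesOver p] [P.IsMaximal] [p.IsMaximal] : relNorm R P = p ^ P.inertiaDeg R := by
  obtain ⟨Q, hQ₁, hQ₂⟩ : ∃ Q : Ideal T, Q.IsMaximal ∧ Q.LiesOver P :=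
    exists_maximal_ideal_liesOver_of_isIntegral P
  have : Q.LiesOver p := LiesOver.trans Q P p
  have h := relNorm_eq_pow_of_isPrime_isGalois Q p
  have : IsGalois (FractionRing S) (FractionRing T) :=
    IsGalois.tower_top_of_isGalois (FractionRing R) (FractionRing S) (FractionRing T)
  rwa [← relNorm_relNorm R S, relNorm_eq_pow_of_isPrime_isGalois Q P, map_pow,
    inertiaDeg_tower (R := R) P Q, pow_mul, pow_left_inj (inertiaDeg_pos Q S).ne'] at h

theorem isGalois_fractionRing_of_isGalois {R T K E : Type*} [CommRing R] [IsDomain R]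
    [CommRing T] [IsDomain T] [Algebra R T] [Module.IsTorsionFree R T] [Field K] [Field E]
    [Algebra R K] [IsFractionRing R K] [Algebra T E] [IsFractionRing T E] [Algebra K E]
    [Algebra R E] [IsScalarTower R K E] [IsScalarTower R T E] [IsGalois K E] :
    let := FractionRing.liftAlgebra R (FractionRing T)
    IsGalois (FractionRing R) (FractionRing T) := by
  let := FractionRing.liftAlgebra R (FractionRing T)
  refine IsGalois.of_equiv_equiv (F := K) (E := E)
    (f := (FractionRing.algEquiv R K).symm.toRingEquiv)
    (g := (FractionRing.algEquiv T E).symm.toRingEquiv) ?_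
  ext
  simpa using! IsFractionRing.algEquiv_commutes (FractionRing.algEquiv R K).symm
      (FractionRing.algEquiv T E).symm _

/-- `Ideal.relNorm_eq_pow_of_isMaximal` for a separable extension of fraction fields. -/
theorem Ideal.relNorm_eq_pow_of_isSeparable {R S : Type*} (K L : Type*) [CommRing R]
    [IsDedekindDomain R]
    [CommRing S] [IsDedekindDomain S] [Algebra R S] [Module.Finite R S] [Module.IsTorsionFree R S]
    [Field K] [Field L] [Algebra R K] [IsFractionRing R K] [Algebra S L] [IsFractionRing S L]
    [Algebra K L] [Algebra R L] [IsScalarTower R K L] [IsScalarTower R S L]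
    [Algebra.IsSeparable K L] [FiniteDimensional K L] (P : Ideal S) (p : Ideal R)
    [P.LiesOver p] [P.IsMaximal] [p.IsMaximal] : relNorm R P = p ^ P.inertiaDeg R := by
  let E := IntermediateField.normalClosure K L (AlgebraicClosure L)
  have : Algebra.IsSeparable K E := by
    refine (le_separableClosure_iff K (AlgebraicClosure L) E).mp ?_
    refine normalClosure_le_iff.mpr fun f => ?_
    rintro _ ⟨y, rfl⟩
    exact mem_separableClosure_iff.mpr
      ((Algebra.IsSeparable.isSeparable K y).map f f.toRingHom.injective)
  have : Normal K (AlgebraicClosure L) := normal_iff.mpr fun x =>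
    ⟨(Algebra.IsAlgebraic.isAlgebraic (R := K) x).isIntegral,
      IsAlgClosed.splits _⟩
  have : IsGalois K E := { }
  have : Algebra.IsSeparable L E := Algebra.isSeparable_tower_top_of_isSeparable K L E
  have : FiniteDimensional L E := Module.Finite.right K L E
  let : Algebra S E := ((algebraMap L E).comp (algebraMap S L)).toAlgebra
  have : IsScalarTower S L E := IsScalarTower.of_algebraMap_eq' rfl
  have : FaithfulSMul S E := (faithfulSMul_iff_algebraMap_injective S E).mpr <|
      (FaithfulSMul.algebraMap_injective L E).comp (FaithfulSMul.algebraMap_injective S L)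
  let : Algebra R E := ((algebraMap L E).comp (algebraMap R L)).toAlgebra
  have : IsScalarTower R L E := IsScalarTower.of_algebraMap_eq' rfl
  have : IsScalarTower R K E := IsScalarTower.of_algebraMap_eq fun x => by
    rw [IsScalarTower.algebraMap_apply R L E, IsScalarTower.algebraMap_apply R K L,
      ← IsScalarTower.algebraMap_apply K L E]
  have : IsScalarTower R S E := IsScalarTower.of_algebraMap_eq fun x => by
    rw [IsScalarTower.algebraMap_apply R L E, IsScalarTower.algebraMap_apply R S L,
      ← IsScalarTower.algebraMap_apply S L E]
  let T := integralClosure S E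
  have : IsFractionRing T E := integralClosure.isFractionRing_of_finite_extension L E
  have : Module.Finite S T := IsIntegralClosure.finite S L E T
  have : IsDedekindDomain T := integralClosure.isDedekindDomain S L E
  have : Module.Finite R T := Module.Finite.trans S T
  have : IsScalarTower R T E := inferInstance
  have : Module.IsTorsionFree S T := Subalgebra.instIsTorsionFree (integralClosure S E)
  have : Module.IsTorsionFree R T := Module.IsTorsionFree.trans_faithfulSMul R S T
  have := isGalois_fractionRing_of_isGalois (R := R) (T := T) (K := K) (E := E)
  exact relNorm_eq_pow_of_isGalois_tower T P p

end RelNorm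

section NormParity

open Polynomial

variable {k A : Type*} [Field k] [CommRing A] [Algebra k[X] A] [Module.Finite k[X] A]

lemma Ideal.finrank_quotient_eq_natDegree_mul_inertiaDeg [Algebra k A] [IsScalarTower k k[X] A]
    (P : Ideal A) [P.IsMaximal] {h : k[X]}
    (hh : P.under k[X] = Ideal.span {h}) :
    Module.finrank k (A ⧸ P) = h.natDegree * P.inertiaDeg k[X] := by
  have : (P.under k[X]).IsMaximal := inferInstance
  rw [Ideal.inertiaDeg_eq_of_isMaximal (P.under k[X]) P, ← finrank_quotient_span_eq_natDegree, ← hh]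
  have : IsScalarTower k (k[X] ⧸ P.under k[X]) (A ⧸ P) := by
    refine IsScalarTower.of_algebraMap_eq (R := k) (S := k[X] ⧸ P.under k[X]) (A := A ⧸ P)
      fun x => ?_
    rw [IsScalarTower.algebraMap_apply k A (A ⧸ P), IsScalarTower.algebraMap_apply k k[X] A]
    rfl
  let := Ideal.Quotient.field (P.under k[X])
  exact (Module.finrank_mul_finrank k (k[X] ⧸ P.under k[X]) (A ⧸ P)).symm

lemma Polynomial.natTrailingDegree_pow_of_isDomain {R : Type*} [CommRing R] [IsDomain R] (f : R[X])
    (n : ℕ) : (f ^ n).natTrailingDegree = n * f.natTrailingDegree := by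
  by_cases hf : f = 0
  · rcases n with _ | n <;> simp [hf]
  induction n with
  | zero => simp
  | succ n ih => rw [pow_succ, natTrailingDegree_mul (pow_ne_zero _ hf) hf, ih]; ring

variable [IsDedekindDomain A] [Module.IsTorsionFree k[X] A]

/-- The ideal norm of `J` is generated by a polynomial whose degree and order of vanishing at `0`
are both even. -/
def Ideal.HasEvenNorm (k : Type*) {A : Type*} [Field k] [CommRing A] [IsDedekindDomain A]
    [Algebra k[X] A] [Module.Finite k[X] A] [Module.IsTorsionFree k[X] A] (J : Ideal A) : Prop :=
  ∃ g : k[X], g ≠ 0 ∧ Ideal.relNorm k[X] J = Ideal.span {g} ∧ Even g.natDegree ∧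
    Even g.natTrailingDegree

lemma Ideal.HasEvenNorm.mul {I J : Ideal A} (hI : I.HasEvenNorm k) (hJ : J.HasEvenNorm k) :
    (I * J).HasEvenNorm k := by
  obtain ⟨f, hf, hfI, h1, h2⟩ := hI
  obtain ⟨g, hg, hgJ, h3, h4⟩ := hJ
  refine ⟨f * g, mul_ne_zero hf hg, ?_, ?_, ?_⟩
  · rw [map_mul, hfI, hgJ, Ideal.span_singleton_mul_span_singleton]
  · rw [natDegree_mul hf hg]; exact h1.add h3
  · rw [natTrailingDegree_mul hf hg]; exact h2.add h4

variable [Algebra k A] [IsScalarTower k k[X] A]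

lemma Ideal.hasEvenNorm_of_isMaximal
    (hnorm : ∀ P : Ideal A, P.IsMaximal →
      Ideal.relNorm k[X] P = P.under k[X] ^ P.inertiaDeg k[X])
    (P : Ideal A) (hP : P.IsMaximal) (hP0 : P ≠ ⊥) (heven : Even (Module.finrank k (A ⧸ P))) :
    P.HasEvenNorm k := by
  obtain ⟨h, hh⟩ := (IsPrincipalIdealRing.principal (P.under k[X])).principal
  have hh : P.under k[X] = Ideal.span {h} := hh
  have hu0 : P.under k[X] ≠ ⊥ := fun h0 => hP0 (Ideal.eq_bot_of_comap_eq_bot (R := k[X]) h0)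
  have h0 : h ≠ 0 := by
    rintro rfl
    exact hu0 (by rw [hh]; simp)
  have hprime : Prime h := by
    rw [← Ideal.span_singleton_prime h0, ← hh]
    infer_instance
  refine ⟨h ^ P.inertiaDeg k[X], pow_ne_zero _ h0, ?_, ?_, ?_⟩
  · rw [hnorm P hP, hh, Ideal.span_singleton_pow]
  · rw [natDegree_pow, mul_comm, ← Ideal.finrank_quotient_eq_natDegree_mul_inertiaDeg P hh]
    exact heven
  · rw [Polynomial.natTrailingDegree_pow_of_isDomain]
    rw [Ideal.finrank_quotient_eq_natDegree_mul_inertiaDeg P hh] at heven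
    by_cases hX : X ∣ h
    · have hass : Associated X h := (prime_X).associated_of_dvd hprime hX
      have : h.natDegree = 1 := by
        rw [← natDegree_eq_of_degree_eq (degree_eq_degree_of_associated hass), natDegree_X]
      rw [this, one_mul] at heven
      exact heven.mul_right _
    · have : h.natTrailingDegree = 0 := by
        rw [natTrailingDegree_eq_zero]
        right
        rwa [X_dvd_iff] at hX
      simp [this]

lemma Ideal.hasEvenNorm_of_forall_prime
    (hnorm : ∀ P : Ideal A, P.IsMaximal →
      Ideal.relNorm k[X] P = P.under k[X] ^ P.inertiaDeg k[X])
    (J : Ideal A) (hJ : J ≠ ⊥)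
    (heven : ∀ P : Ideal A, P.IsPrime → P ≠ ⊥ → J ≤ P → Even (Module.finrank k (A ⧸ P))) :
    J.HasEvenNorm k := by
  induction J using UniqueFactorizationMonoid.induction_on_prime with
  | h₁ => exact absurd rfl hJ
  | h₂ u hu =>
    rw [Ideal.isUnit_iff] at hu
    subst hu
    refine ⟨1, one_ne_zero, ?_, by simp, by simp⟩
    rw [Ideal.relNorm_top, Ideal.span_singleton_one]
  | h₃ I P hI hP ih =>
    have hPP := Ideal.isPrime_of_prime hP
    have hP0 : P ≠ ⊥ := hP.ne_zero
    refine Ideal.HasEvenNorm.mul ?_ (ih hI fun Q hQ hQ0 hle =>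
      heven Q hQ hQ0 (Ideal.mul_le_right.trans hle))
    exact Ideal.hasEvenNorm_of_isMaximal hnorm P (hPP.isMaximal hP0) hP0
      (heven P hPP hP0 Ideal.mul_le_left)

end NormParity

section Specialization

lemma IsDedekindDomain.exists_primitive_specialization {A ι : Type*} [CommRing A]
    [IsDedekindDomain A] [Fintype ι] (P : Ideal A) (hP : P ≠ ⊤) (v : ι → A) (hv : v ≠ 0) :
    ∃ w : ι → A, (∃ i, w i ∉ P) ∧ ∀ B : Matrix ι ι A,
      B.quadEval v ∈ P * Ideal.span (Set.range v) ^ 2 → B.quadEval w ∈ P := by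
  set I := Ideal.span (Set.range v) with hI
  obtain ⟨i₀, hi₀⟩ := Function.ne_iff.mp hv
  have hvI : ∀ i, v i ∈ I := fun i => Ideal.subset_span ⟨i, rfl⟩
  obtain ⟨c, hc0, hcI⟩ : ∃ c : A, c ≠ 0 ∧ c ∈ I := ⟨v i₀, hi₀, hvI i₀⟩
  obtain ⟨I', hI'⟩ : I ∣ Ideal.span {c} :=
    Ideal.dvd_iff_le.mpr ((Ideal.span_singleton_le_iff_mem _).mpr hcI)
  have hcspan : Ideal.span {c} ≠ (0 : Ideal A) := by simpa using hc0
  obtain ⟨a, haI', haI⟩ : ∃ a ∈ I', ∃ i, a * v i ∉ Ideal.span {c} * P := by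
    by_contra! hcon
    have hle : Ideal.span {c} ≤ Ideal.span {c} * P := by
      conv_lhs => rw [hI', mul_comm]
      rw [Ideal.mul_le]
      intro a ha x hx
      have : I ≤ Submodule.comap (LinearMap.mulLeft A a) (Ideal.span {c} * P) := by
        rw [hI, Ideal.span_le]
        rintro _ ⟨i, rfl⟩
        exact hcon a ha i
      exact this hx
    rw [← Ideal.dvd_iff_le] at hle
    have h1 : Ideal.span {c} * P ∣ Ideal.span {c} * 1 := by rwa [mul_one]
    rw [mul_dvd_mul_iff_left hcspan] at h1
    exact hP (Ideal.isUnit_iff.mp (isUnit_of_dvd_one h1))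
  have hex : ∀ i, ∃ w, a * v i = c * w := fun i => by
    have : a * v i ∈ Ideal.span {c} := by
      rw [hI', mul_comm I]
      exact Ideal.mul_mem_mul haI' (hvI i)
    exact Ideal.mem_span_singleton.mp this
  choose w hw using hex
  refine ⟨w, ?_, fun B hB => ?_⟩
  · obtain ⟨i, hi⟩ := haI
    refine ⟨i, fun hiP => hi ?_⟩
    rw [hw i]
    exact Ideal.mul_mem_mul (Ideal.mem_span_singleton_self c) hiP
  · have h1 : c ^ 2 * B.quadEval w = a ^ 2 * B.quadEval v := by
      rw [← Matrix.quadEval_smul, ← Matrix.quadEval_smul]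
      simp_rw [hw]
    have h2 : a ^ 2 * B.quadEval v ∈ Ideal.span {c ^ 2} * P := by
      have := Ideal.mul_mem_mul (Ideal.pow_mem_pow haI' 2) hB
      convert this using 1
      rw [← Ideal.span_singleton_pow, hI']
      ring
    rw [← h1, Ideal.mem_span_singleton_mul] at h2
    obtain ⟨z, hz, hz'⟩ := h2
    rwa [← mul_left_cancel₀ (pow_ne_zero 2 hc0) hz']

lemma hasOddZero_of_odd_finrank_quotient {k A : Type u} {ι : Type*} [Field k] [CommRing A]
    [IsDedekindDomain A] [Fintype ι] [Algebra k A] (P : Ideal A) [P.IsPrime] (hP : P ≠ ⊥)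
    (hodd : Odd (Module.finrank k (A ⧸ P))) (v : ι → A) (hv : v ≠ 0) {S : Set (Matrix ι ι k)}
    (hS : ∀ B ∈ S, (B.map (algebraMap k A)).quadEval v ∈ P * Ideal.span (Set.range v) ^ 2) :
    HasOddZero S := by
  have : P.IsMaximal := Ideal.IsPrime.isMaximal ‹_› hP
  obtain ⟨w, ⟨i, hi⟩, hw⟩ := IsDedekindDomain.exists_primitive_specialization P this.ne_top v hv
  let := Ideal.Quotient.field P
  have : FiniteDimensional k (A ⧸ P) := Module.finite_of_finrank_pos hodd.pos
  refine ⟨A ⧸ P, inferInstance, algebraMap k (A ⧸ P), IsOddFiniteExt.of_algebra _ _ hodd,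
    fun i => Ideal.Quotient.mk P (w i), ?_, fun B hB => ?_⟩
  · intro h
    exact hi (Ideal.Quotient.eq_zero_iff_mem.mp (congrFun h i))
  · have : B.map (algebraMap k (A ⧸ P)) = (B.map (algebraMap k A)).map (Ideal.Quotient.mk P) := by
      ext i j
      rfl
    rw [this, Matrix.quadEval_map]
    exact Ideal.Quotient.eq_zero_iff_mem.mpr (hw _ (hS B hB))

end Specialization

section NormOfValue

open Polynomial

lemma Matrix.quadEval_mem_span_sq {A ι : Type*} [CommRing A] [Fintype ι] (B : Matrix ι ι A)
    (v : ι → A) : B.quadEval v ∈ Ideal.span (Set.range v) ^ 2 := by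
  refine Ideal.sum_mem _ fun i _ => Ideal.sum_mem _ fun j _ => ?_
  rw [mul_assoc, pow_two]
  exact Ideal.mul_mem_left _ _ (Ideal.mul_mem_mul (Ideal.subset_span ⟨i, rfl⟩)
    (Ideal.subset_span ⟨j, rfl⟩))

lemma Polynomial.natTrailingDegree_eq_of_associated {R : Type*} [CommRing R] [IsDomain R]
    {f g : R[X]} (h : Associated f g) : f.natTrailingDegree = g.natTrailingDegree := by
  obtain ⟨u, rfl⟩ := h
  by_cases hf : f = 0
  · simp [hf]
  · have hu : (u : R[X]).natTrailingDegree = 0 :=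
      Nat.le_zero.mp ((natTrailingDegree_le_natDegree _).trans
        (natDegree_eq_zero_of_isUnit u.isUnit).le)
    rw [natTrailingDegree_mul hf u.ne_zero, hu, add_zero]

section Integral

variable {k A : Type u} {ι : Type*} [Fintype ι] [Field k] [CommRing A] [IsDedekindDomain A]
  [Algebra k[X] A] [Module.Finite k[X] A] [Module.IsTorsionFree k[X] A] [Algebra k A]
  [IsScalarTower k k[X] A]

lemma even_natDegree_intNorm_quadEval
    (hnorm : ∀ P : Ideal A, P.IsMaximal →
      Ideal.relNorm k[X] P = P.under k[X] ^ P.inertiaDeg k[X])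
    (hodd : Odd (Module.finrank k[X] A))
    {S : Set (Matrix ι ι k)} {B₀ B₁ : Matrix ι ι k} (H : ¬ HasOddZero (S ∪ {B₀, B₁}))
    (r : A) (v : ι → A) (hv : v ≠ 0) (hS : ∀ B ∈ S, (B.map (algebraMap k A)).quadEval v = 0)
    (h01 : (B₀.map (algebraMap k A)).quadEval v = r * (B₁.map (algebraMap k A)).quadEval v) :
    (B₁.map (algebraMap k A)).quadEval v ≠ 0 ∧
    Even (Algebra.intNorm k[X] A ((B₁.map (algebraMap k A)).quadEval v)).natDegree ∧
    Even (Algebra.intNorm k[X] A ((B₁.map (algebraMap k A)).quadEval v)).natTrailingDegree := by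
  set I := Ideal.span (Set.range v) with hI
  set a := (B₁.map (algebraMap k A)).quadEval v with ha
  have key : ∀ P : Ideal A, P.IsPrime → P ≠ ⊥ → a ∈ P * I ^ 2 →
      Even (Module.finrank k (A ⧸ P)) := by
    intro P hP hP0 haP
    by_contra hnot
    rw [Nat.not_even_iff_odd] at hnot
    refine H (hasOddZero_of_odd_finrank_quotient P hP0 hnot v hv ?_)
    rintro B (hB | rfl | rfl)
    · rw [hS B hB]; exact zero_mem _
    · rw [h01]; exact Ideal.mul_mem_left _ _ haP
    · exact haP
  have hinj : Function.Injective (algebraMap k[X] A) := FaithfulSMul.algebraMap_injective _ _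
  have ha0 : a ≠ 0 := by
    intro ha0
    have hJ : (Ideal.span {X}).map (algebraMap k[X] A) ≠ ⊥ := by
      rw [Ideal.map_span, Set.image_singleton, Ne, Ideal.span_singleton_eq_bot]
      exact (map_ne_zero_iff _ hinj).mpr X_ne_zero
    obtain ⟨g, hg, hgn, hgd, -⟩ := Ideal.hasEvenNorm_of_forall_prime (k := k) hnorm _ hJ
      fun P hP hP0 _ => key P hP hP0 (by rw [ha0]; exact zero_mem _)
    rw [Ideal.relNorm_algebraMap, Ideal.span_singleton_pow,
      Ideal.span_singleton_eq_span_singleton] at hgn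
    rw [← natDegree_eq_of_degree_eq (degree_eq_degree_of_associated hgn), natDegree_X_pow] at hgd
    exact (Nat.not_even_iff_odd.mpr hodd) hgd
  have hI0 : I ≠ 0 := by
    obtain ⟨i, hi⟩ := Function.ne_iff.mp hv
    intro h
    have hmem : v i ∈ I := Ideal.subset_span ⟨i, rfl⟩
    rw [h] at hmem
    exact hi ((Submodule.mem_bot _).mp hmem)
  obtain ⟨J, hJ⟩ : I ^ 2 ∣ Ideal.span {a} :=
    Ideal.dvd_iff_le.mpr ((Ideal.span_singleton_le_iff_mem _).mpr (Matrix.quadEval_mem_span_sq _ _))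
  have hJ0 : J ≠ ⊥ := by
    rintro rfl
    rw [Ideal.mul_bot, Ideal.span_singleton_eq_bot] at hJ
    exact ha0 hJ
  have hJe : J.HasEvenNorm k := Ideal.hasEvenNorm_of_forall_prime hnorm J hJ0 fun P hP hP0 hle => by
    refine key P hP hP0 (Ideal.mul_mono_left hle ?_)
    rw [mul_comm, ← hJ]
    exact Ideal.mem_span_singleton_self a
  have hIe : (I ^ 2).HasEvenNorm k := by
    obtain ⟨h, hh⟩ := (IsPrincipalIdealRing.principal (Ideal.relNorm k[X] I)).principal
    have hh : Ideal.relNorm k[X] I = Ideal.span {h} := hh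
    have h0 : h ≠ 0 := by
      rintro rfl
      rw [Ideal.span_singleton_zero] at hh
      exact hI0 (Ideal.relNorm_eq_bot_iff.mp hh)
    refine ⟨h ^ 2, pow_ne_zero _ h0, ?_, ?_, ?_⟩
    · rw [map_pow, hh, Ideal.span_singleton_pow]
    · rw [natDegree_pow]; exact even_two_mul _
    · rw [Polynomial.natTrailingDegree_pow_of_isDomain]; exact even_two_mul _
  obtain ⟨g, hg, hgn, hgd, hgt⟩ := hIe.mul hJe
  rw [← hJ, Ideal.relNorm_singleton, Ideal.span_singleton_eq_span_singleton] at hgn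
  refine ⟨ha0, ?_, ?_⟩
  · rwa [natDegree_eq_of_degree_eq (degree_eq_degree_of_associated hgn)]
  · rwa [Polynomial.natTrailingDegree_eq_of_associated hgn]

end Integral

/-- Clearing denominators in `even_natDegree_intNorm_quadEval`. The inclusion of `k[X]` in its
fraction field `K` is a parameter `φ`, so that this applies both to `X ↦ t` and `X ↦ t⁻¹`. -/
lemma exists_norm_quadEval_mul_sq_eq {k K L : Type u} {ι : Type*} [Fintype ι] [Field k] [Field K]
    [Field L] [Algebra K L] [FiniteDimensional K L] [Algebra.IsSeparable K L] (φ : k[X] →+* K)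
    (hφ : letI := φ.toAlgebra; IsFractionRing k[X] K) (hodd : Odd (Module.finrank K L))
    {S : Set (Matrix ι ι k)} {B₀ B₁ : Matrix ι ι k} (H : ¬ HasOddZero (S ∪ {B₀, B₁}))
    (f : k →+* L) (hf : f = (algebraMap K L).comp (φ.comp C))
    (r : k[X]) (v : ι → L) (hv : v ≠ 0)
    (hS : ∀ B ∈ S, (B.map f).quadEval v = 0)
    (h01 : (B₀.map f).quadEval v = algebraMap K L (φ r) * (B₁.map f).quadEval v) :
    ∃ g h : k[X], g ≠ 0 ∧ h ≠ 0 ∧ Even g.natDegree ∧ Even g.natTrailingDegree ∧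
      Algebra.norm K ((B₁.map f).quadEval v) * φ h ^ 2 = φ g := by
  let := φ.toAlgebra
  have : IsFractionRing k[X] K := hφ
  let := ((algebraMap K L).comp φ).toAlgebra
  have : IsScalarTower k[X] K L := IsScalarTower.of_algebraMap_eq' rfl
  let := f.toAlgebra
  have : IsScalarTower k k[X] L := IsScalarTower.of_algebraMap_eq' hf
  have : Module.IsTorsionFree k[X] L := Module.IsTorsionFree.trans_faithfulSMul k[X] K L
  let A := integralClosure k[X] L
  have : Module.IsTorsionFree k[X] A := Subalgebra.instIsTorsionFree (integralClosure k[X] L)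
  have : Module.Finite k[X] A := IsIntegralClosure.finite k[X] K L A
  have : IsDedekindDomain A := integralClosure.isDedekindDomain k[X] K L
  have : IsFractionRing A L := integralClosure.isFractionRing_of_finite_extension K L
  have hnorm : ∀ P : Ideal A, P.IsMaximal →
      Ideal.relNorm k[X] P = P.under k[X] ^ P.inertiaDeg k[X] := fun P hP => by
    have : (P.under k[X]).IsMaximal := inferInstance
    exact Ideal.relNorm_eq_pow_of_isSeparable K L P _
  have hrank : Module.finrank k[X] A = Module.finrank K L := (IsFractionRing.finrank_eq k[X] K A L).symm
  obtain ⟨b, hb⟩ := IsLocalization.exist_integer_multiples_of_finite (nonZeroDivisors A) v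
  choose u hu using hb
  obtain ⟨c, hcmem⟩ := b
  have hc0 : c ≠ 0 := nonZeroDivisors.ne_zero hcmem
  have hinj : Function.Injective (algebraMap A L) := IsFractionRing.injective A L
  have hu' : (fun i => algebraMap A L (u i)) = fun i => algebraMap A L c * v i := by
    funext i
    rw [hu i, Algebra.smul_def]
  have heval : ∀ B : Matrix ι ι k, algebraMap A L ((B.map (algebraMap k A)).quadEval u) =
      algebraMap A L c ^ 2 * (B.map f).quadEval v := fun B => by
    rw [← Matrix.quadEval_smul, ← hu', ← Matrix.quadEval_map, Matrix.map_map]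
    rfl
  have hu0 : u ≠ 0 := by
    rintro rfl
    refine hv (funext fun i => ?_)
    have := congrFun hu' i
    simp only [Pi.zero_apply, map_zero] at this
    exact (mul_eq_zero.mp this.symm).resolve_left ((map_ne_zero_iff _ hinj).mpr hc0)
  obtain ⟨ha0, hd, ht⟩ := even_natDegree_intNorm_quadEval hnorm (hrank ▸ hodd) H
    (algebraMap k[X] A r) u hu0
    (fun B hB => hinj (by rw [heval, hS B hB, mul_zero, map_zero]))
    (hinj (by
      rw [map_mul, heval, heval, h01, ← IsScalarTower.algebraMap_apply k[X] A L]
      change _ * (algebraMap k[X] L r * _) = _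
      ring))
  refine ⟨_, Algebra.intNorm k[X] A c, (Algebra.intNorm_ne_zero).mpr ha0,
    (Algebra.intNorm_ne_zero).mpr hc0, hd, ht, ?_⟩
  change _ * algebraMap k[X] K _ ^ 2 = algebraMap k[X] K _
  rw [Algebra.algebraMap_intNorm (L := L), Algebra.algebraMap_intNorm (L := L), heval, map_mul,
    map_pow, mul_comm]

end NormOfValue

section SeparableCase

open Polynomial

lemma RingHom.isFractionRing_toAlgebra {R K : Type*} [CommRing R] [Field K] (φ : R →+* K)
    (hinj : Function.Injective φ) (hsurj : ∀ z, ∃ x y, z = φ x / φ y) :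
    let := φ.toAlgebra
    IsFractionRing R K := by
  let := φ.toAlgebra
  have : FaithfulSMul R K := (faithfulSMul_iff_algebraMap_injective _ _).mpr hinj
  exact IsFractionRing.of_field R K hsurj

variable {k : Type u} [Field k]

lemma RatFunc.intDegree_pow_of_ne_zero {x : RatFunc k} (hx : x ≠ 0) (n : ℕ) :
    (x ^ n).intDegree = n * x.intDegree := by
  induction n with
  | zero => simp
  | succ n ih =>
    rw [pow_succ, RatFunc.intDegree_mul (pow_ne_zero _ hx) hx, ih]
    push_cast
    ring

/-- The embedding `k[X] → k(X)` sending `X` to `X⁻¹`. -/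
def Polynomial.toRatFuncInv (k : Type u) [Field k] : k[X] →+* RatFunc k :=
  eval₂RingHom (RatFunc.C (K := k)) (RatFunc.X)⁻¹

lemma Polynomial.eval₂_ratFunc_X (f : k[X]) :
    f.eval₂ (RatFunc.C (K := k)) RatFunc.X = algebraMap k[X] (RatFunc k) f := by
  induction f using Polynomial.induction_on' with
  | add p q hp hq => rw [eval₂_add, hp, hq, map_add]
  | monomial n a => simp [← C_mul_X_pow_eq_monomial]

lemma Polynomial.toRatFuncInv_apply (f : k[X]) : toRatFuncInv k f =
    algebraMap k[X] (RatFunc k) f.reverse * (RatFunc.X⁻¹) ^ f.natDegree := by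
  let := invertibleOfNonzero (inv_ne_zero (RatFunc.X_ne_zero (K := k)))
  have := eval₂_reverse_mul_pow (RatFunc.C (K := k)) (RatFunc.X⁻¹) f
  rw [invOf_eq_inv, inv_inv, eval₂_ratFunc_X] at this
  exact this.symm

lemma Polynomial.toRatFuncInv_reverse_mul (f : k[X]) :
    toRatFuncInv k f.reverse * RatFunc.X ^ f.natDegree = algebraMap k[X] (RatFunc k) f := by
  let := invertibleOfNonzero (RatFunc.X_ne_zero (K := k))
  have := eval₂_reverse_mul_pow (RatFunc.C (K := k)) (RatFunc.X) f
  rwa [invOf_eq_inv, eval₂_ratFunc_X] at this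

lemma Polynomial.toRatFuncInv_ne_zero {f : k[X]} (hf : f ≠ 0) : toRatFuncInv k f ≠ 0 := by
  rw [toRatFuncInv_apply]
  refine mul_ne_zero ?_ (pow_ne_zero _ (inv_ne_zero RatFunc.X_ne_zero))
  exact (map_ne_zero_iff _ (RatFunc.algebraMap_injective k)).mpr (by simpa using hf)

lemma Polynomial.intDegree_toRatFuncInv {f : k[X]} (hf : f ≠ 0) :
    (toRatFuncInv k f).intDegree = -f.natTrailingDegree := by
  have hr : algebraMap k[X] (RatFunc k) f.reverse ≠ 0 :=
    (map_ne_zero_iff _ (RatFunc.algebraMap_injective k)).mpr (by simpa using hf)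
  have h1 := RatFunc.intDegree_mul hr
    (pow_ne_zero f.natDegree (inv_ne_zero (RatFunc.X_ne_zero (K := k))))
  rw [← toRatFuncInv_apply, RatFunc.intDegree_polynomial, reverse_natDegree,
    RatFunc.intDegree_pow_of_ne_zero (inv_ne_zero RatFunc.X_ne_zero), RatFunc.intDegree_inv, RatFunc.intDegree_X] at h1
  rw [h1, Nat.cast_sub (natTrailingDegree_le_natDegree f)]
  ring

lemma Polynomial.isFractionRing_toRatFuncInv :
    let := (toRatFuncInv k).toAlgebra
    IsFractionRing k[X] (RatFunc k) := by
  refine RingHom.isFractionRing_toAlgebra _ ((injective_iff_map_eq_zero _).mpr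
    fun f hf => by_contra fun h => toRatFuncInv_ne_zero h hf) fun z => ?_
  induction z using RatFunc.induction_on with
  | f p q hq =>
    refine ⟨p.reverse * X ^ q.natDegree, q.reverse * X ^ p.natDegree, ?_⟩
    have hX : toRatFuncInv k X = RatFunc.X⁻¹ := by simp [toRatFuncInv]
    have hX0 := RatFunc.X_ne_zero (K := k)
    have hq0 : toRatFuncInv k q.reverse ≠ 0 := toRatFuncInv_ne_zero (by simpa using hq)
    rw [← toRatFuncInv_reverse_mul p, ← toRatFuncInv_reverse_mul q, map_mul, map_mul, map_pow,
      map_pow, hX, inv_pow, inv_pow]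
    field_simp

/-- A common zero over a separable odd degree extension of `k(X)`. -/
lemma hasOddZero_of_isSeparable {L : Type u} {ι : Type*} [Fintype ι] [Field L]
    [Algebra (RatFunc k) L] [FiniteDimensional (RatFunc k) L] [Algebra.IsSeparable (RatFunc k) L]
    (hodd : Odd (Module.finrank (RatFunc k) L)) {S : Set (Matrix ι ι k)} {B₀ B₁ : Matrix ι ι k}
    {r : ℕ} (hr : Odd r) (v : ι → L) (hv : v ≠ 0)
    (hS : ∀ B ∈ S, (B.map ((algebraMap (RatFunc k) L).comp RatFunc.C)).quadEval v = 0)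
    (h01 : (B₀.map ((algebraMap (RatFunc k) L).comp RatFunc.C)).quadEval v =
      -(algebraMap (RatFunc k) L RatFunc.X ^ r *
        (B₁.map ((algebraMap (RatFunc k) L).comp RatFunc.C)).quadEval v)) :
    HasOddZero (S ∪ {B₀, B₁}) := by
  by_contra H
  have hX0 := RatFunc.X_ne_zero (K := k)
  have hX0' : algebraMap (RatFunc k) L RatFunc.X ≠ 0 := (_root_.map_ne_zero _).mpr hX0
  obtain ⟨g, h, hg, hh, hgd, -, hgh⟩ := exists_norm_quadEval_mul_sq_eq
    (algebraMap k[X] (RatFunc k))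
    (RingHom.isFractionRing_toAlgebra _ (RatFunc.algebraMap_injective k) fun z => by
      induction z using RatFunc.induction_on with
      | f p q hq => exact ⟨p, q, rfl⟩) hodd H ((algebraMap (RatFunc k) L).comp RatFunc.C)
    (by congr 1) (-X ^ r) v hv hS (by rw [h01]; simp)
  obtain ⟨g', h', hg', hh', -, hgt', hgh'⟩ := exists_norm_quadEval_mul_sq_eq
    (toRatFuncInv k) isFractionRing_toRatFuncInv hodd (Set.pair_comm B₀ B₁ ▸ H)
    ((algebraMap (RatFunc k) L).comp RatFunc.C)
    (by congr 1; ext x; simp [toRatFuncInv]) (-X ^ r) v hv hS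
    (by
      rw [h01]
      simp [toRatFuncInv]
      field_simp)
  have e1 : algebraMap (RatFunc k) L RatFunc.X ^ r = algebraMap (RatFunc k) L (RatFunc.X ^ r) := by
    simp
  set a := (B₁.map ((algebraMap (RatFunc k) L).comp RatFunc.C)).quadEval v
  have hg0 : algebraMap k[X] (RatFunc k) g ≠ 0 :=
    (map_ne_zero_iff _ (RatFunc.algebraMap_injective k)).mpr hg
  have hh0 : algebraMap k[X] (RatFunc k) h ≠ 0 :=
    (map_ne_zero_iff _ (RatFunc.algebraMap_injective k)).mpr hh
  have ha0 : Algebra.norm (RatFunc k) a ≠ 0 := by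
    intro h0
    rw [h0, zero_mul] at hgh
    exact hg0 hgh.symm
  have hb0 : Algebra.norm (RatFunc k)
      ((B₀.map ((algebraMap (RatFunc k) L).comp RatFunc.C)).quadEval v) ≠ 0 := by
    intro h0
    rw [h0, zero_mul] at hgh'
    exact toRatFuncInv_ne_zero hg' hgh'.symm
  have hd := congrArg RatFunc.intDegree hgh
  have hd' := congrArg RatFunc.intDegree hgh'
  rw [RatFunc.intDegree_mul ha0 (pow_ne_zero 2 hh0), RatFunc.intDegree_pow_of_ne_zero hh0,
    RatFunc.intDegree_polynomial, RatFunc.intDegree_polynomial] at hd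
  rw [RatFunc.intDegree_mul hb0 (pow_ne_zero 2 (toRatFuncInv_ne_zero hh')),
    RatFunc.intDegree_pow_of_ne_zero (toRatFuncInv_ne_zero hh'),
    intDegree_toRatFuncInv hh', intDegree_toRatFuncInv hg'] at hd'
  have hab : (Algebra.norm (RatFunc k)
      ((B₀.map ((algebraMap (RatFunc k) L).comp RatFunc.C)).quadEval v)).intDegree =
      r * Module.finrank (RatFunc k) L + (Algebra.norm (RatFunc k) a).intDegree := by
    rw [h01, e1, ← neg_mul, ← map_neg, map_mul, Algebra.norm_algebraMap,
      RatFunc.intDegree_mul (pow_ne_zero _ (neg_ne_zero.mpr (pow_ne_zero _ hX0))) ha0,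
      RatFunc.intDegree_pow_of_ne_zero (neg_ne_zero.mpr (pow_ne_zero _ hX0)), RatFunc.intDegree_neg,
      RatFunc.intDegree_pow_of_ne_zero hX0, RatFunc.intDegree_X]
    ring
  rw [hab] at hd'
  have hrn : Odd ((r : ℤ) * Module.finrank (RatFunc k) L) := by exact_mod_cast hr.mul hodd
  obtain ⟨x, hx⟩ := hgd
  obtain ⟨y, hy⟩ := hgt'
  obtain ⟨z, hz⟩ := hrn
  rw [hz] at hd'
  omega

end SeparableCase

section Frobenius

lemma Matrix.quadEval_map_iterateFrobenius {R R' ι : Type*} [Fintype ι] [CommRing R] [CommRing R']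
    (f : R →+* R') (p : ℕ) [ExpChar R p] [ExpChar R' p] (m : ℕ) (B : Matrix ι ι R) (v : ι → R') :
    ((B.map (iterateFrobenius R p m)).map f).quadEval (fun i => v i ^ p ^ m) =
      (B.map f).quadEval v ^ p ^ m := by
  have h1 : (B.map (iterateFrobenius R p m)).map f = (B.map f).map (iterateFrobenius R' p m) := by
    ext i j
    simp [iterateFrobenius_def]
  rw [h1]
  exact Matrix.quadEval_map (iterateFrobenius R' p m) (B.map f) v

lemma HasOddZero.of_map_iterateFrobenius {k : Type u} {ι : Type*} [Fintype ι] [Field k] (p : ℕ)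
    [ExpChar k p] (hp : Odd p) (m : ℕ) {S : Set (Matrix ι ι k)}
    (h : HasOddZero ((fun B => B.map (iterateFrobenius k p m)) '' S)) : HasOddZero S := by
  obtain ⟨L, _, g, hg, w, hw, hB⟩ := h
  have : ExpChar L p := expChar_of_injective_ringHom g.injective p
  have hroot : ∀ i, ∃ u : AlgebraicClosure L, u ^ p ^ m = algebraMap L _ (w i) := fun i =>
    IsAlgClosed.exists_pow_nat_eq _ (pow_pos (expChar_pos L p) m)
  choose u hu using hroot
  let E := IntermediateField.adjoin L (Set.range u)
  have : FiniteDimensional L E := IntermediateField.finiteDimensional_adjoin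
    fun x _ => (Algebra.IsAlgebraic.isAlgebraic (R := L) x).isIntegral
  have : IsPurelyInseparable L E := by
    refine (IntermediateField.isPurelyInseparable_adjoin_iff_pow_mem L _ p).mpr ?_
    rintro _ ⟨i, rfl⟩
    exact ⟨m, w i, (hu i).symm⟩
  have hodd : Odd (Module.finrank L E) := by
    obtain ⟨n, hn⟩ := IsPurelyInseparable.finrank_eq_pow L E p
    rw [hn]
    exact hp.pow
  have : ExpChar E p := expChar_of_injective_algebraMap (algebraMap L E).injective p
  refine ⟨E, inferInstance, (algebraMap L E).comp g, hg.comp (IsOddFiniteExt.of_algebra L E hodd),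
    fun i => ⟨u i, IntermediateField.subset_adjoin _ _ ⟨i, rfl⟩⟩, ?_, fun B hBS => ?_⟩
  · intro h0
    refine hw (funext fun i => ?_)
    have h1 : u i = 0 := congrArg Subtype.val (congrFun h0 i)
    have h2 := hu i
    rw [h1, zero_pow (pow_pos (expChar_pos L p) m).ne'] at h2
    exact (map_eq_zero _).mp h2.symm
  · refine pow_eq_zero_iff (pow_pos (expChar_pos L p) m).ne' |>.mp ?_
    rw [← Matrix.quadEval_map_iterateFrobenius]
    have h1 : (fun i => (⟨u i, IntermediateField.subset_adjoin _ _ ⟨i, rfl⟩⟩ : E) ^ p ^ m) =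
        fun i => algebraMap L E (w i) := by
      funext i
      exact Subtype.ext (hu i)
    have h2 : (B.map (iterateFrobenius k p m)).map ((algebraMap L E).comp g) =
        ((B.map (iterateFrobenius k p m)).map g).map (algebraMap L E) := by
      ext; rfl
    rw [h1, h2, Matrix.quadEval_map, hB _ ⟨B, hBS, rfl⟩, map_zero]

/-- A common zero of forms over `k` and of `B₀ + t B₁` over an odd degree extension of `k(t)`
yields a common zero of all these forms over an odd degree extension of `k`. -/
lemma HasOddZero.of_ratFunc {k : Type u} {ι : Type*} [Fintype ι] [Field k] (p : ℕ) [ExpChar k p]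
    (hp : Odd p) {S : Set (Matrix ι ι k)} {B₀ B₁ : Matrix ι ι k}
    (h : HasOddZero ((fun B => B.map RatFunc.C) '' S ∪
      {B₀.map RatFunc.C + (RatFunc.X : RatFunc k) • B₁.map RatFunc.C})) :
    HasOddZero (S ∪ {B₀, B₁}) := by
  obtain ⟨E, _, g, ⟨hfd, hodd⟩, v, hv, hB⟩ := h
  let := g.toAlgebra
  have : FiniteDimensional (RatFunc k) E := hfd
  have : ExpChar (RatFunc k) p := expChar_of_injective_ringHom (RatFunc.C (K := k)).injective p
  let Es := separableClosure (RatFunc k) E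
  have : ExpChar Es p := expChar_of_injective_algebraMap (algebraMap (RatFunc k) Es).injective p
  have : ExpChar E p := expChar_of_injective_algebraMap (algebraMap (RatFunc k) E).injective p
  have hodd' : Odd (Module.finrank (RatFunc k) Es) := by
    have h1 := Module.finrank_mul_finrank (RatFunc k) Es E
    exact Nat.Odd.of_mul_left (h1 ▸ hodd)
  obtain ⟨m, hm⟩ : ∃ m, ∀ i, v i ^ p ^ m ∈ (algebraMap Es E).range := by
    choose n hn using fun i => IsPurelyInseparable.pow_mem Es p (v i)
    refine ⟨Finset.univ.sup n, fun i => ?_⟩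
    obtain ⟨d, hd⟩ := Nat.exists_eq_add_of_le (Finset.le_sup (f := n) (Finset.mem_univ i))
    rw [hd, pow_add, pow_mul]
    exact pow_mem (hn i) _
  choose u hu using hm
  have hpm := (pow_pos (expChar_pos k p) m).ne'
  have hinj : Function.Injective (algebraMap Es E) := (algebraMap Es E).injective
  have heval : ∀ B : Matrix ι ι k, algebraMap Es E (((B.map (iterateFrobenius k p m)).map
      ((algebraMap (RatFunc k) Es).comp RatFunc.C)).quadEval u) =
      (B.map (g.comp RatFunc.C)).quadEval v ^ p ^ m := fun B => by
    rw [← Matrix.quadEval_map, ← Matrix.quadEval_map_iterateFrobenius]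
    simp_rw [hu]
    rfl
  refine HasOddZero.of_map_iterateFrobenius p hp m ?_
  rw [Set.image_union, Set.image_pair]
  refine hasOddZero_of_isSeparable hodd' (hp.pow (n := m)) u ?_ ?_ ?_
  · rintro rfl
    refine hv (funext fun i => ?_)
    have := hu i
    simp only [Pi.zero_apply, map_zero] at this
    exact (pow_eq_zero_iff hpm).mp this.symm
  · rintro _ ⟨B, hBS, rfl⟩
    refine hinj ?_
    rw [heval, map_zero, pow_eq_zero_iff hpm]
    exact hB _ (Or.inl ⟨B, hBS, rfl⟩)
  · refine hinj ?_
    have h0 := hB _ (Or.inr rfl)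
    have h1 : (B₀.map RatFunc.C + (RatFunc.X : RatFunc k) • B₁.map RatFunc.C).map g =
        B₀.map (g.comp RatFunc.C) + g RatFunc.X • B₁.map (g.comp RatFunc.C) := by
      ext; simp
    rw [h1, Matrix.quadEval_add, Matrix.quadEval_const_smul] at h0
    rw [map_neg, map_mul, heval, heval, map_pow, ← IsScalarTower.algebraMap_apply,
      eq_neg_of_add_eq_zero_left h0, (hp.pow (n := m)).neg_pow, mul_pow]
    rfl

end Frobenius

section Induction

lemma HasOddZero.mono {K : Type u} {ι : Type*} [Fintype ι] [Field K] {S T : Set (Matrix ι ι K)}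
    (h : HasOddZero T) (hST : S ⊆ T) : HasOddZero S := by
  obtain ⟨L, _, g, hg, w, hw, hB⟩ := h
  exact ⟨L, _, g, hg, w, hw, fun B hBS => hB B (hST hBS)⟩

lemma Matrix.map_add_sum_smul {R R' ι α : Type*} [CommSemiring R] [CommSemiring R'] (f : R →+* R')
    (A : Matrix ι ι R) (s : Finset α) (c : α → R) (B : α → Matrix ι ι R) :
    (A + ∑ a ∈ s, c a • B a).map f = A.map f + ∑ a ∈ s, f (c a) • (B a).map f := by
  ext i j
  simp [Matrix.sum_apply]

/-- `k(t_1, …, t_{M+1})` embeds in `k(t_1, …, t_M)(t)`. -/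
lemma exists_ringHom_fractionRing_ratFunc (k : Type*) [Field k] (M : ℕ) (F F' : Type*) [Field F]
    [Field F'] [Algebra (MvPolynomial (Fin M) k) F] [IsFractionRing (MvPolynomial (Fin M) k) F]
    [Algebra (MvPolynomial (Fin (M + 1)) k) F'] [IsFractionRing (MvPolynomial (Fin (M + 1)) k) F'] :
    ∃ f : F' →+* RatFunc F,
      (∀ a, f (algebraMap (MvPolynomial (Fin (M + 1)) k) F' (MvPolynomial.C a)) =
        RatFunc.C (algebraMap (MvPolynomial (Fin M) k) F (MvPolynomial.C a))) ∧
      f (algebraMap (MvPolynomial (Fin (M + 1)) k) F' (MvPolynomial.X 0)) = RatFunc.X ∧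
      ∀ i : Fin M, f (algebraMap (MvPolynomial (Fin (M + 1)) k) F' (MvPolynomial.X i.succ)) =
        RatFunc.C (algebraMap (MvPolynomial (Fin M) k) F (MvPolynomial.X i)) := by
  let φ : MvPolynomial (Fin (M + 1)) k →+* RatFunc F :=
    (algebraMap (Polynomial F) (RatFunc F)).comp
      ((Polynomial.mapRingHom (algebraMap (MvPolynomial (Fin M) k) F)).comp
        (MvPolynomial.finSuccEquiv k M).toRingEquiv.toRingHom)
  have hφ_apply : ∀ x, φ x = algebraMap (Polynomial F) (RatFunc F)
      ((MvPolynomial.finSuccEquiv k M x).map (algebraMap (MvPolynomial (Fin M) k) F)) :=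
    fun _ => rfl
  have hφ : Function.Injective φ := (RatFunc.algebraMap_injective F).comp
    ((Polynomial.map_injective _ (IsFractionRing.injective _ F)).comp
      (MvPolynomial.finSuccEquiv k M).injective)
  have hφ' : ∀ x, IsFractionRing.lift hφ (algebraMap _ F' x) = φ x :=
    IsFractionRing.lift_algebraMap hφ
  refine ⟨IsFractionRing.lift hφ, fun a => ?_, ?_, fun i => ?_⟩
  · rw [hφ', hφ_apply, MvPolynomial.finSuccEquiv_apply, MvPolynomial.eval₂Hom_C]
    simp
  · rw [hφ', hφ_apply, MvPolynomial.finSuccEquiv_X_zero, Polynomial.map_X, RatFunc.algebraMap_X]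
  · rw [hφ', hφ_apply, MvPolynomial.finSuccEquiv_X_succ, Polynomial.map_C, RatFunc.algebraMap_C]

lemma HasOddZero.of_fractionRing_mvPolynomial {k : Type u} {ι : Type*} [Fintype ι] [Field k] (p : ℕ)
    [ExpChar k p] (hp : Odd p) (M : ℕ) : ∀ (S : Set (Matrix ι ι k)) (B₀ : Matrix ι ι k)
    (B : Fin M → Matrix ι ι k),
    HasOddZero ((fun B => B.map (toFrac k M)) '' S ∪
      {B₀.map (toFrac k M) + ∑ i, algebraMap (MvPolynomial (Fin M) k)
        (FractionRing (MvPolynomial (Fin M) k)) (MvPolynomial.X i) • (B i).map (toFrac k M)}) →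
    HasOddZero (S ∪ insert B₀ (Set.range B)) := by
  induction M with
  | zero =>
    intro S B₀ B h
    have hinj : Function.Injective (MvPolynomial.isEmptyRingEquiv k (Fin 0)).toRingHom :=
      (MvPolynomial.isEmptyRingEquiv k (Fin 0)).injective
    let f : FractionRing (MvPolynomial (Fin 0) k) →+* k := IsFractionRing.lift hinj
    have hf' : ∀ x, f (algebraMap _ _ x) = (MvPolynomial.isEmptyRingEquiv k (Fin 0)).toRingHom x :=
      IsFractionRing.lift_algebraMap hinj
    have hf : ∀ A : Matrix ι ι k, (A.map (toFrac k 0)).map f = A := fun A => by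
      ext i j
      simp only [Matrix.map_apply, toFrac, RingHom.comp_apply]
      rw [hf']
      exact (MvPolynomial.coeff_C _ _).trans (if_pos rfl)
    refine (h.map f).mono ?_
    rintro A (hA | rfl | ⟨i, -⟩)
    · exact ⟨_, Or.inl ⟨A, hA, rfl⟩, hf A⟩
    · exact ⟨_, Or.inr rfl, by simpa using hf A⟩
    · exact i.elim0
  | succ M ih =>
    intro S B₀ B h
    obtain ⟨f, hfC, hf0, hfs⟩ := exists_ringHom_fractionRing_ratFunc k M
      (FractionRing (MvPolynomial (Fin M) k)) (FractionRing (MvPolynomial (Fin (M + 1)) k))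
    have : ExpChar (FractionRing (MvPolynomial (Fin M) k)) p :=
      expChar_of_injective_ringHom (toFrac k M).injective p
    have hfm : ∀ A : Matrix ι ι k, (A.map (toFrac k (M + 1))).map f =
        (A.map (toFrac k M)).map RatFunc.C := fun A => by
      ext i j
      exact hfC (A i j)
    have h1 := HasOddZero.of_ratFunc p hp
      (S := (fun B => B.map (toFrac k M)) '' S)
      (B₀ := B₀.map (toFrac k M) + ∑ i : Fin M, algebraMap (MvPolynomial (Fin M) k)
        (FractionRing (MvPolynomial (Fin M) k)) (MvPolynomial.X i) • (B i.succ).map (toFrac k M))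
      (B₁ := (B 0).map (toFrac k M)) <| by
        refine (h.map f).mono ?_
        rintro _ (⟨_, ⟨A, hA, rfl⟩, rfl⟩ | rfl)
        · exact ⟨_, Or.inl ⟨A, hA, rfl⟩, hfm A⟩
        · refine ⟨_, Or.inr rfl, ?_⟩
          refine (Matrix.map_add_sum_smul f _ _ _ _).trans ?_
          rw [Matrix.map_add_sum_smul, Fin.sum_univ_succ, hf0, hfm, hfm]
          simp only [hfs, hfm]
          abel
    have h2 := ih (S ∪ {B 0}) B₀ (fun i => B i.succ) (h1.mono ?_)
    · refine h2.mono ?_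
      rintro A (hA | rfl | ⟨i, rfl⟩)
      · exact Or.inl (Or.inl hA)
      · exact Or.inr (Or.inl rfl)
      · refine Fin.cases ?_ (fun j => ?_) i
        · exact Or.inl (Or.inr rfl)
        · exact Or.inr (Or.inr ⟨j, rfl⟩)
    · rintro _ (⟨A, hA | rfl, rfl⟩ | rfl)
      · exact Or.inl ⟨A, hA, rfl⟩
      · exact Or.inr (Or.inr rfl)
      · exact Or.inr (Or.inl rfl)

end Induction
/-- **Theorem of Colliot-Thélène and Levine.** Let `q_0, q_1, …, q_M` be quadratic forms on
`k^{N+1}`, let `F = k(t_1, …, t_M)` and let `q_η = q_0 + t_1 q_1 + ⋯ + t_M q_M` be the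
generic representative of the linear system, a quadratic form over `F`. Then `q_η` is
isotropic over some finite extension of `F` of odd degree iff the base set of the linear
system (the common zero locus of `q_0, …, q_M`) has a nonzero point over some finite
extension of `k` of odd degree. -/
theorem colliotThelene_levine {k : Type u} [Field k] (hk : ringChar k ≠ 2) (N M : ℕ)
    (q₀ : QuadraticForm k (Fin (N + 1) → k))
    (q : Fin M → QuadraticForm k (Fin (N + 1) → k)) :
    -- the generic quadratic form `q_η = q_0 + t_1 q_1 + ⋯ + t_M q_M` over `F = k(t_1, …, t_M)`
    letI F := FractionRing (MvPolynomial (Fin M) k)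
    letI qη : QuadraticForm F (Fin (N + 1) → F) :=
      q₀.mapAlong (toFrac k M) +
        ∑ i : Fin M,
          (algebraMap (MvPolynomial (Fin M) k) F (MvPolynomial.X i)) • (q i).mapAlong (toFrac k M)
    ((∃ (E : Type u) (_ : Field E) (f : F →+* E),
        IsOddFiniteExt F E f ∧
        ∃ v : Fin (N + 1) → E, v ≠ 0 ∧ (qη.mapAlong f) v = 0) ↔
      (∃ (L : Type u) (_ : Field L) (g : k →+* L),
        IsOddFiniteExt k L g ∧
        ∃ w : Fin (N + 1) → L, w ≠ 0 ∧
          (q₀.mapAlong g) w = 0 ∧ ∀ i, ((q i).mapAlong g) w = 0)) := by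
  let F := FractionRing (MvPolynomial (Fin M) k)
  let qη : QuadraticForm F (Fin (N + 1) → F) :=
    q₀.mapAlong (toFrac k M) +
      ∑ i : Fin M,
        (algebraMap (MvPolynomial (Fin M) k) F (MvPolynomial.X i)) • (q i).mapAlong (toFrac k M)
  change (∃ (E : Type u) (_ : Field E) (f : F →+* E), IsOddFiniteExt F E f ∧
    ∃ v : Fin (N + 1) → E, v ≠ 0 ∧ (qη.mapAlong f) v = 0) ↔ _
  obtain ⟨p, hexp⟩ := ExpChar.exists k
  have hp : Odd p := by
    rcases hexp with _ | hprime
    · exact odd_one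
    · exact hprime.odd_of_ne_two fun h => hk (h ▸ ringChar.eq k p |>.symm ▸ rfl)
  have hqη : qη.upperMatrix = q₀.upperMatrix.map (toFrac k M) +
      ∑ i, algebraMap (MvPolynomial (Fin M) k) F (MvPolynomial.X i) •
        (q i).upperMatrix.map (toFrac k M) := by
    simp only [qη, QuadraticForm.upperMatrix_add, QuadraticForm.upperMatrix_sum,
      QuadraticForm.upperMatrix_smul, QuadraticForm.upperMatrix_mapAlong]
  constructor
  · rintro ⟨E, _, f, hf, v, hv, h0⟩
    obtain ⟨L, _, g, hg, w, hw, hB⟩ := HasOddZero.of_fractionRing_mvPolynomial p hp M ∅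
      q₀.upperMatrix (fun i => (q i).upperMatrix) ⟨E, _, f, hf, v, hv, by
        rintro _ (⟨_, hA, -⟩ | rfl)
        · exact hA.elim
        · rw [← hqη, ← QuadraticForm.mapAlong_apply, h0]⟩
    refine ⟨L, _, g, hg, w, hw, ?_, fun i => ?_⟩
    · rw [QuadraticForm.mapAlong_apply]
      exact hB _ (Or.inr (Or.inl rfl))
    · rw [QuadraticForm.mapAlong_apply]
      exact hB _ (Or.inr (Or.inr ⟨i, rfl⟩))
  · rintro ⟨L, _, g, hg, w, hw, h0, hi⟩
    have h : HasOddZero (insert q₀.upperMatrix (Set.range fun i => (q i).upperMatrix)) :=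
      ⟨L, _, g, hg, w, hw, by
        rintro _ (rfl | ⟨i, rfl⟩)
        · rw [← QuadraticForm.mapAlong_apply, h0]
        · rw [← QuadraticForm.mapAlong_apply, hi]⟩
    obtain ⟨E, _, f, hf, v, hv, hB⟩ := h.map (toFrac k M)
    refine ⟨E, _, f, hf, v, hv, ?_⟩
    have hB₀ := hB _ ⟨_, Or.inl rfl, rfl⟩
    have hBi := fun i => hB _ ⟨_, Or.inr ⟨i, rfl⟩, rfl⟩
    have hmap : qη.upperMatrix.map f = (q₀.upperMatrix.map (toFrac k M)).map f +
        ∑ i, f (algebraMap (MvPolynomial (Fin M) k) F (MvPolynomial.X i)) •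
          ((q i).upperMatrix.map (toFrac k M)).map f := by
      rw [hqη, Matrix.map_add_sum_smul]
    rw [QuadraticForm.mapAlong_apply, hmap, Matrix.quadEval_add, Matrix.quadEval_sum, hB₀, zero_add]
    refine Finset.sum_eq_zero fun i _ => ?_
    rw [Matrix.quadEval_const_smul]
    exact mul_eq_zero_of_right _ (hBi i)
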